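/- arXiv:1309.2167 — 3 statements merged into one kernel-verified Lean document; each statement's English description precedes it below -/
import Mathlib

section
/- For every z = x + iy with y > 0 one has Im(Γ′(z)/Γ(z)) = ∑_{k=0}^∞ y/((x+k)² + y²); in particular the digamma function ψ = Γ′/Γ has strictly positive imaginary part at every point of the open upper half plane. -/
open Complex

open Filter Topology in
/-- The harmonic numbers, shifted by one index, still differ from the logarithm by `γ`. -/
theorem tendsto_sum_range_succ_inv_sub_log :
    Tendsto (fun n : ℕ ↦ ∑ k ∈ Finset.range (n + 1), ((k : ℂ) + 1)⁻¹ - (Real.log n : ℂ)) atTop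
      (𝓝 (Real.eulerMascheroniConstant : ℂ)) := by
  have hreal : Tendsto (fun n : ℕ ↦ ((harmonic n : ℝ) - Real.log n) + 1 / ((n : ℝ) + 1)) atTop
      (𝓝 (Real.eulerMascheroniConstant + 0)) :=
    Real.tendsto_harmonic_sub_log.add tendsto_one_div_add_atTop_nhds_zero_nat
  rw [add_zero] at hreal
  refine ((continuous_ofReal.tendsto _).comp hreal).congr fun n ↦ ?_
  rw [Finset.sum_range_succ]
  simp [harmonic]
  ring

/-- A translate by a natural number of a point of the upper half plane is nonzero. -/
theorem add_natCast_ne_zero_of_im_pos {w : ℂ} (hw : 0 < w.im) (k : ℕ) : w + k ≠ 0 := by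
  intro h
  have := congrArg Complex.im h
  simp at this
  exact hw.ne' this

/-- The terms of the digamma series are `O(1 / (k + 1) ^ 2)`, uniformly for `w` bounded and
bounded away from the real axis. -/
theorem norm_inv_sub_inv_add_natCast_le {w : ℂ} {R δ : ℝ} (hδ : 0 < δ) (hw : δ ≤ w.im)
    (hR : ‖w‖ ≤ R) (k : ℕ) :
    ‖((k : ℂ) + 1)⁻¹ - (w + k)⁻¹‖ ≤ (R + 1) * (1 + (R + 1) / δ) * (1 / ((k : ℝ) + 1) ^ 2) := by
  have hwk : w + k ≠ 0 := add_natCast_ne_zero_of_im_pos (hδ.trans_le hw) k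
  have hk : (k : ℂ) + 1 ≠ 0 := Nat.cast_add_one_ne_zero k
  have hnk : ‖(k : ℂ) + 1‖ = (k : ℝ) + 1 := by
    rw [← Nat.cast_add_one, norm_natCast, Nat.cast_add_one]
  have hR0 : 0 ≤ R := (norm_nonneg w).trans hR
  have him : δ ≤ ‖w + k‖ := by
    have := (le_abs_self _).trans (abs_im_le_norm (w + k))
    simp only [add_im, natCast_im, add_zero] at this
    exact hw.trans this
  have hre : (k : ℝ) - R ≤ ‖w + k‖ := by
    have := norm_sub_norm_le (k : ℂ) (-w)
    rw [norm_natCast, norm_neg, sub_neg_eq_add, add_comm (k : ℂ)] at this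
    linarith
  have hlower : (k : ℝ) + 1 ≤ (1 + (R + 1) / δ) * ‖w + k‖ := by
    have : R + 1 ≤ (R + 1) / δ * ‖w + k‖ := by
      rw [div_mul_eq_mul_div, le_div_iff₀ hδ]
      gcongr
    linarith
  have hnum : ‖w - 1‖ ≤ R + 1 := (norm_sub_le _ _).trans (by simpa using hR)
  have hpos : 0 < ‖w + k‖ := norm_pos_iff.mpr hwk
  rw [show ((k : ℂ) + 1)⁻¹ - (w + k)⁻¹ = (w - 1) / ((k + 1) * (w + k)) by field_simp; ring,
    norm_div, norm_mul, hnk, mul_one_div, div_le_div_iff₀ (by positivity) (by positivity)]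
  calc ‖w - 1‖ * ((k : ℝ) + 1) ^ 2
      ≤ (R + 1) * (((k : ℝ) + 1) * ((1 + (R + 1) / δ) * ‖w + k‖)) := by
        rw [pow_two]
        gcongr
    _ = (R + 1) * (1 + (R + 1) / δ) * (((k : ℝ) + 1) * ‖w + k‖) := by ring

/-- Quotients of the approximating sequence of `Γ`, as exponentials of sums of logarithms. -/
theorem exp_sum_range_eq_GammaSeq_div {w z : ℂ} (hw : 0 < w.im) (hz : 0 < z.im) {n : ℕ}
    (hn : n ≠ 0) :
    exp (∑ k ∈ Finset.range (n + 1),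
        ((w - z) * ((k : ℂ) + 1)⁻¹ - (log (w + k) - log (z + k)))) =
      GammaSeq w n / GammaSeq z n *
        exp ((w - z) * (∑ k ∈ Finset.range (n + 1), ((k : ℂ) + 1)⁻¹ - (Real.log n : ℂ))) := by
  have hexp {v : ℂ} (hv : 0 < v.im) :
      exp (∑ k ∈ Finset.range (n + 1), log (v + k)) = ∏ k ∈ Finset.range (n + 1), (v + k) := by
    rw [exp_sum]
    exact Finset.prod_congr rfl fun k _ ↦ exp_log (add_natCast_ne_zero_of_im_pos hv k)
  have hprod {v : ℂ} (hv : 0 < v.im) : ∏ k ∈ Finset.range (n + 1), (v + k) ≠ 0 :=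
    Finset.prod_ne_zero_iff.mpr fun k _ ↦ add_natCast_ne_zero_of_im_pos hv k
  have hn' : (n : ℂ) ≠ 0 := Nat.cast_ne_zero.mpr hn
  have hfac : (n.factorial : ℂ) ≠ 0 := Nat.cast_ne_zero.mpr n.factorial_ne_zero
  rw [Finset.sum_sub_distrib, Finset.sum_sub_distrib, ← Finset.mul_sum, mul_sub,
    exp_sub, exp_sub, exp_sub, hexp hw, hexp hz, GammaSeq, GammaSeq,
    cpow_def_of_ne_zero hn', cpow_def_of_ne_zero hn', ofReal_log n.cast_nonneg, ofReal_natCast,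
    sub_mul w z (log n), exp_sub, mul_comm (log (n : ℂ)), mul_comm (log (n : ℂ))]
  have hpw := hprod hw
  have hpz := hprod hz
  field_simp

open Filter Topology in
/-- The series expansion of the digamma function on the upper half plane. -/
theorem hasSum_digamma_of_im_pos {z : ℂ} (hz : 0 < z.im) :
    HasSum (fun k : ℕ ↦ ((k : ℂ) + 1)⁻¹ - (z + k)⁻¹)
      (digamma z + Real.eulerMascheroniConstant) := by
  set γ : ℂ := (Real.eulerMascheroniConstant : ℂ)
  set δ : ℝ := z.im / 2 with hδ
  have hδ0 : 0 < δ := half_pos hz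
  set R : ℝ := ‖z‖ + δ with hR
  set u : ℕ → ℝ := fun k ↦ (R + 1) * (1 + (R + 1) / δ) * (1 / ((k : ℝ) + 1) ^ 2)
  set g : ℕ → ℂ → ℂ := fun k w ↦ (w - z) * ((k : ℂ) + 1)⁻¹ - (log (w + k) - log (z + k))
  have hsum : Summable u := by
    refine Summable.mul_left _ ?_
    exact_mod_cast (summable_nat_add_iff 1).mpr (Real.summable_one_div_nat_pow.mpr one_lt_two)
  have hzmem : z ∈ Metric.ball z δ := Metric.mem_ball_self hδ0
  have him {w : ℂ} (hw : w ∈ Metric.ball z δ) : δ ≤ w.im := by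
    have h := (neg_le_abs _).trans ((abs_im_le_norm (w - z)).trans (mem_ball_iff_norm.mp hw).le)
    rw [sub_im] at h
    linarith
  have himpos {w : ℂ} (hw : w ∈ Metric.ball z δ) : 0 < w.im := hδ0.trans_le (him hw)
  have hbound (k : ℕ) (w : ℂ) (hw : w ∈ Metric.ball z δ) :
      ‖((k : ℂ) + 1)⁻¹ - (w + k)⁻¹‖ ≤ u k := by
    refine norm_inv_sub_inv_add_natCast_le hδ0 (him hw) ?_ k
    have := norm_sub_norm_le w z
    have := (mem_ball_iff_norm.mp hw).le
    linarith
  have hderiv (k : ℕ) (w : ℂ) (hw : w ∈ Metric.ball z δ) :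
      HasDerivAt (g k) (((k : ℂ) + 1)⁻¹ - (w + k)⁻¹) w := by
    have hslit : w + k ∈ slitPlane := by
      refine mem_slitPlane_iff.mpr (Or.inr ?_)
      simpa using (himpos hw).ne'
    have hlog := (((hasDerivAt_id w).add_const (k : ℂ)).clog hslit).sub_const (log (z + k))
    have hlin := ((hasDerivAt_id w).sub_const z).mul_const ((k : ℂ) + 1)⁻¹
    simpa [g] using hlin.fun_sub hlog
  have hgz (k : ℕ) : g k z = 0 := by simp [g]
  have hgz_sum : Summable fun k ↦ g k z := by simpa only [hgz] using summable_zero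
  have hconn : IsPreconnected (Metric.ball z δ) := (convex_ball z δ).isPreconnected
  have hS := hasDerivAt_tsum_of_isPreconnected hsum Metric.isOpen_ball hconn hderiv hbound hzmem
    hgz_sum hzmem
  have hΓ {w : ℂ} (hw : 0 < w.im) : Gamma w ≠ 0 := Gamma_ne_zero fun m h ↦
    add_natCast_ne_zero_of_im_pos hw m (by rw [h, neg_add_cancel])
  have hquot {w : ℂ} (hw : w ∈ Metric.ball z δ) :
      exp (∑' k, g k w) = Gamma w / Gamma z * exp ((w - z) * γ) := by
    have hgw : Summable fun k ↦ g k w := summable_of_summable_hasDerivAt_of_isPreconnected hsum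
      Metric.isOpen_ball hconn hderiv hbound hzmem hgz_sum hw
    have hlim := (continuous_exp.tendsto _).comp
      (hgw.hasSum.tendsto_sum_nat.comp (tendsto_add_atTop_nat 1))
    have hlim' := ((GammaSeq_tendsto_Gamma w).div (GammaSeq_tendsto_Gamma z) (hΓ hz)).mul
      ((continuous_exp.tendsto _).comp (tendsto_sum_range_succ_inv_sub_log.const_mul (w - z)))
    refine tendsto_nhds_unique hlim (hlim'.congr' ?_)
    filter_upwards [eventually_ne_atTop 0] with n hn
    exact (exp_sum_range_eq_GammaSeq_div (himpos hw) hz hn).symm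
  have hGamma : Gamma =ᶠ[𝓝 z] fun w ↦ Gamma z * exp (∑' k, g k w - (w - z) * γ) := by
    filter_upwards [Metric.ball_mem_nhds z hδ0] with w hw
    rw [exp_sub, hquot hw]
    have := exp_ne_zero ((w - z) * γ)
    have := hΓ hz
    field_simp
  have hexp := ((hS.sub (((hasDerivAt_id z).sub_const z).mul_const γ)).cexp.const_mul
    (Gamma z)).congr_of_eventuallyEq hGamma
  have hval : digamma z + γ = ∑' k : ℕ, (((k : ℂ) + 1)⁻¹ - (z + k)⁻¹) := by
    rw [digamma_def, logDeriv_apply, hexp.deriv]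
    have := hΓ hz
    simp only [Pi.sub_apply, hgz, tsum_zero, id, sub_self, zero_mul, exp_zero, one_mul]
    field_simp
    ring
  rw [hval]
  exact (Summable.of_norm_bounded hsum fun k ↦ hbound k z hzmem).hasSum

/-- The imaginary part of the digamma function as a sum of Poisson kernels. -/
theorem hasSum_digamma_im {x y : ℝ} (hy : 0 < y) :
    HasSum (fun k : ℕ ↦ y / ((x + k) ^ 2 + y ^ 2)) (digamma (x + y * I)).im := by
  have h := hasSum_im (hasSum_digamma_of_im_pos (z := x + y * I) (by simpa using hy))
  rw [add_im, ofReal_im, add_zero] at h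
  refine h.congr_fun fun k ↦ ?_
  have hk : (((k : ℂ) + 1)⁻¹).im = 0 := by
    rw [← Nat.cast_add_one, ← ofReal_natCast, ← ofReal_inv, ofReal_im]
  rw [sub_im, hk, inv_im, normSq_apply]
  simp [pow_two, neg_div]

/-- For `z = x + iy` with `y > 0`,
`Im (Γ'(z)/Γ(z)) = ∑_{k=0}^∞ y/((x+k)² + y²)`; in particular the digamma function
`ψ = Γ'/Γ` has strictly positive imaginary part on the open upper half plane. -/
theorem digamma_im_eq_tsum_and_pos :
    (∀ x y : ℝ, 0 < y →
      (deriv Complex.Gamma (x + y * I) / Complex.Gamma (x + y * I)).im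
        = ∑' k : ℕ, y / ((x + k) ^ 2 + y ^ 2)) ∧
    (∀ z : ℂ, 0 < z.im → 0 < (deriv Complex.Gamma z / Complex.Gamma z).im) := by
  refine ⟨fun x y hy ↦ (hasSum_digamma_im hy).tsum_eq.symm, fun z hz ↦ ?_⟩
  have h := hasSum_digamma_im (x := z.re) hz
  rw [re_add_im] at h
  have hpos (k : ℕ) : 0 < z.im / ((z.re + k) ^ 2 + z.im ^ 2) := by positivity
  exact (hpos 0).trans_le (le_hasSum h 0 fun k _ ↦ (hpos k).le)
end

section
/- For each fixed y > 0, the map x ↦ Im L(x + iy) is a strictly increasing bijection from ℝ onto ℝ. Moreover Im L(iy) → +∞ as y → +∞. -/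
open Complex Filter

/-- The holomorphic branch `L` of `log Γ` on `ℂ ∖ (−∞,0]`:
`L(z) = −γz − Log z − ∑_{k=1}^∞ (Log(1 + z/k) − z/k)`. -/
noncomputable def logGamma (z : ℂ) : ℂ :=
  -(Real.eulerMascheroniConstant : ℂ) * z - Complex.log z -
    ∑' k : ℕ, (Complex.log (1 + z / (k + 1)) - z / (k + 1))

namespace logGamma

/-- For `y > 0`, the argument of `x + iy` is `π / 2 - arctan (x / y)`. -/
lemma arg_add_mul_I {y : ℝ} (hy : 0 < y) (x : ℝ) :
    arg (x + y * I) = Real.pi / 2 - Real.arctan (x / y) := by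
  have hs : 0 < √(1 + (x / y) ^ 2) := Real.sqrt_pos.2 (by positivity)
  have h := arg_mul_cos_add_sin_mul_I (mul_pos hy hs)
    (θ := Real.pi / 2 - Real.arctan (x / y))
    ⟨by linarith [Real.arctan_lt_pi_div_two (x / y), Real.pi_pos],
      by linarith [Real.neg_pi_div_two_lt_arctan (x / y), Real.pi_pos]⟩
  rw [← h, ← ofReal_cos, ← ofReal_sin, Real.cos_pi_div_two_sub, Real.sin_pi_div_two_sub,
    Real.sin_arctan, Real.cos_arctan]
  congr 1
  have hx : y * √(1 + (x / y) ^ 2) * (x / y / √(1 + (x / y) ^ 2)) = x := by field_simp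
  have hy' : y * √(1 + (x / y) ^ 2) * (1 / √(1 + (x / y) ^ 2)) = y := by field_simp
  rw [mul_add, ← mul_assoc, ← ofReal_mul, ← ofReal_mul, hx, hy']

/-- The `k`-th term of the series for the imaginary part of `logGamma (x + iy)`. -/
noncomputable def imTerm (y : ℝ) (k : ℕ) (x : ℝ) : ℝ :=
  y / (k + 1) - (Real.pi / 2 - Real.arctan ((x + (k + 1)) / y))

lemma im_log_sub_eq_neg_imTerm {y : ℝ} (hy : 0 < y) (x : ℝ) (k : ℕ) :
    (Complex.log (1 + (x + y * I) / (k + 1)) - (x + y * I) / (k + 1)).im = -imTerm y k x := by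
  have hk : (0 : ℝ) < k + 1 := by positivity
  have hkc : (k + 1 : ℂ) ≠ 0 := by exact_mod_cast hk.ne'
  have h1 : (1 + (x + y * I) / (k + 1) : ℂ)
      = ((k + 1 : ℝ)⁻¹ : ℝ) * (((x + (k + 1) : ℝ) : ℂ) + y * I) := by
    push_cast
    field_simp
    ring
  have h2 : ((x + y * I) / (k + 1) : ℂ).im = y / (k + 1) := by
    have : ((x + y * I) / (k + 1) : ℂ) = (x + y * I) / ((k + 1 : ℝ) : ℂ) := by push_cast; rfl
    rw [this, div_ofReal_im]
    simp
  rw [sub_im, h2, log_im, h1, arg_real_mul _ (inv_pos.2 hk), arg_add_mul_I hy, imTerm]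
  ring

lemma summable_log_one_add_div_sub_div (z : ℂ) :
    Summable fun k : ℕ => Complex.log (1 + z / (k + 1)) - z / (k + 1) := by
  have hsq : Summable fun k : ℕ => ‖z / (k + 1)‖ ^ 2 := by
    have h := ((summable_nat_add_iff 1).2
      (Real.summable_one_div_nat_pow.2 one_lt_two)).mul_left (‖z‖ ^ 2)
    refine h.congr fun k => ?_
    have : ‖(k + 1 : ℂ)‖ = k + 1 := by exact_mod_cast Complex.norm_natCast (k + 1)
    rw [norm_div, this, div_pow, mul_one_div]
    push_cast
    rfl
  refine hsq.of_norm_bounded_eventually ?_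
  filter_upwards [hsq.tendsto_cofinite_zero.eventually_le_const
    (show (0 : ℝ) < (1 / 2) ^ 2 by norm_num)] with k hk
  have hk' : ‖z / (k + 1)‖ ≤ 1 / 2 := (sq_le_sq₀ (norm_nonneg _) (by norm_num)).1 hk
  refine (norm_log_one_add_sub_self_le (by linarith)).trans ?_
  have : (1 - ‖z / (k + 1)‖)⁻¹ ≤ 2 := inv_le_of_inv_le₀ (by norm_num) (by linarith)
  nlinarith [sq_nonneg ‖z / (k + 1 : ℂ)‖]

lemma summable_imTerm {y : ℝ} (hy : 0 < y) (x : ℝ) : Summable fun k => imTerm y k x := by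
  have h := (summable_log_one_add_div_sub_div (x + y * I)).mapL imCLM
  simp only [imCLM_apply, im_log_sub_eq_neg_imTerm hy] at h
  simpa using h.neg

lemma im_add_mul_I {y : ℝ} (hy : 0 < y) (x : ℝ) :
    (logGamma (x + y * I)).im = -Real.eulerMascheroniConstant * y
      - (Real.pi / 2 - Real.arctan (x / y)) + ∑' k, imTerm y k x := by
  have h := imCLM.map_tsum (summable_log_one_add_div_sub_div (x + y * I))
  simp only [imCLM_apply, im_log_sub_eq_neg_imTerm hy, tsum_neg] at h
  rw [logGamma, sub_im, sub_im, h, log_im, arg_add_mul_I hy]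
  simp

lemma strictMono_imTerm {y : ℝ} (hy : 0 < y) (k : ℕ) : StrictMono (imTerm y k) := by
  intro a b hab
  have : Real.arctan ((a + (k + 1)) / y) < Real.arctan ((b + (k + 1)) / y) :=
    Real.arctan_strictMono (by gcongr)
  unfold imTerm
  linarith

lemma continuous_imTerm (y : ℝ) (k : ℕ) : Continuous (imTerm y k) := by
  unfold imTerm
  fun_prop

lemma pi_div_two_sub_arctan_le_div {x y : ℝ} (hx : 0 < x) (hy : 0 < y) :
    Real.pi / 2 - Real.arctan (x / y) ≤ y / x := by
  rw [← Real.arctan_inv_of_pos (div_pos hx hy), inv_div]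
  have h := Real.le_tan (Real.arctan_nonneg.2 (div_pos hy hx).le)
    (Real.arctan_lt_pi_div_two (y / x))
  rwa [Real.tan_arctan] at h

lemma imTerm_nonneg {x y : ℝ} (hx : 0 ≤ x) (hy : 0 < y) (k : ℕ) : 0 ≤ imTerm y k x := by
  refine le_trans ?_ ((strictMono_imTerm hy k).monotone hx)
  have := pi_div_two_sub_arctan_le_div (x := k + 1) (by positivity) hy
  rw [imTerm, zero_add]
  linarith

lemma strictMono_im {y : ℝ} (hy : 0 < y) :
    StrictMono fun x : ℝ => (logGamma (x + y * I)).im := by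
  intro a b hab
  have h1 : Real.arctan (a / y) < Real.arctan (b / y) := Real.arctan_strictMono (by gcongr)
  have h2 := (summable_imTerm hy a).tsum_le_tsum
    (fun k => (strictMono_imTerm hy k).monotone hab.le) (summable_imTerm hy b)
  simp only [im_add_mul_I hy]
  linarith

lemma continuous_im {y : ℝ} (hy : 0 < y) :
    Continuous fun x : ℝ => (logGamma (x + y * I)).im := by
  simp only [im_add_mul_I hy]
  refine Continuous.add (by fun_prop) (continuous_iff_continuousAt.2 fun c => ?_)
  refine ContinuousOn.continuousAt (s := Set.Icc (c - 1) (c + 1)) ?_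
    (Icc_mem_nhds (by linarith) (by linarith))
  refine continuousOn_tsum (fun k => (continuous_imTerm y k).continuousOn)
    ((summable_imTerm hy (c - 1)).abs.add (summable_imTerm hy (c + 1)).abs) fun k x hx => ?_
  have h1 := (strictMono_imTerm hy k).monotone hx.1
  have h2 := (strictMono_imTerm hy k).monotone hx.2
  rw [Real.norm_eq_abs, abs_le]
  constructor <;>
    linarith [neg_abs_le (imTerm y k (c - 1)), le_abs_self (imTerm y k (c + 1)),
      abs_nonneg (imTerm y k (c - 1)), abs_nonneg (imTerm y k (c + 1))]

lemma tendsto_im_atTop {y : ℝ} (hy : 0 < y) :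
    Tendsto (fun x : ℝ => (logGamma (x + y * I)).im) atTop atTop := by
  refine tendsto_atTop_atTop_of_monotone (strictMono_im hy).monotone fun b => ?_
  obtain ⟨N, hN, hN1⟩ := ((Real.tendsto_sum_range_one_div_nat_succ_atTop.eventually_ge_atTop
    ((b + Real.eulerMascheroniConstant * y + Real.pi / 2 + y) / y)).and
      (eventually_ge_atTop 1)).exists
  have hN0 : (0 : ℝ) < N := by exact_mod_cast hN1
  refine ⟨N, ?_⟩
  rw [im_add_mul_I hy]
  have h0 : 0 ≤ Real.arctan (N / y) := Real.arctan_nonneg.2 (by positivity)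
  have h1 := (summable_imTerm hy N).sum_le_tsum (Finset.range N)
    fun k _ => imTerm_nonneg hN0.le hy k
  have h2 : y * (∑ k ∈ Finset.range N, 1 / ((k : ℝ) + 1)) - y
      ≤ ∑ k ∈ Finset.range N, imTerm y k N := by
    have : y = ∑ k ∈ Finset.range N, y / N := by
      rw [Finset.sum_const, Finset.card_range, nsmul_eq_mul]
      field_simp
    conv_lhs => rw [Finset.mul_sum]; enter [2]; rw [this]
    rw [← Finset.sum_sub_distrib]
    refine Finset.sum_le_sum fun k _ => ?_
    have h3 := pi_div_two_sub_arctan_le_div (x := N + (k + 1)) (by positivity) hy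
    have h4 : y / ((N : ℝ) + (k + 1)) ≤ y / N := by
      gcongr
      have : (0 : ℝ) ≤ k + 1 := by positivity
      linarith
    rw [imTerm, mul_one_div]
    linarith
  rw [div_le_iff₀ hy] at hN
  linarith

lemma tendsto_im_atBot {y : ℝ} (hy : 0 < y) :
    Tendsto (fun x : ℝ => (logGamma (x + y * I)).im) atBot atBot := by
  refine tendsto_atBot_atBot_of_monotone (strictMono_im hy).monotone fun b => ?_
  set d := Real.arctan (1 / y)
  have hd : 0 < d := Real.arctan_pos.2 (by positivity)
  obtain ⟨N, hN⟩ := exists_nat_ge (((logGamma ((0 : ℝ) + y * I)).im - b) / d)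
  have hx : -(N : ℝ) ≤ 0 := by simp
  refine ⟨-(N : ℝ), ?_⟩
  rw [div_le_iff₀ hd] at hN
  rw [im_add_mul_I hy] at hN ⊢
  have h0 : Real.arctan (-(N : ℝ) / y) ≤ Real.arctan (0 / y) :=
    Real.arctan_mono (by gcongr)
  have hs := (summable_imTerm hy 0).sub (summable_imTerm hy (-N))
  have h1 := hs.sum_le_tsum (Finset.range N)
    fun k _ => sub_nonneg.2 ((strictMono_imTerm hy k).monotone hx)
  rw [(summable_imTerm hy 0).tsum_sub (summable_imTerm hy (-N))] at h1
  have h2 : N * d ≤ ∑ k ∈ Finset.range N, (imTerm y k 0 - imTerm y k (-N)) := by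
    rw [← nsmul_eq_mul]
    nth_rw 1 [← Finset.card_range N]
    refine Finset.card_nsmul_le_sum _ _ _ fun k hk => ?_
    have hkN : (k : ℝ) + 1 ≤ N := by exact_mod_cast Finset.mem_range.1 hk
    have h3 : d ≤ Real.arctan ((0 + ((k : ℝ) + 1)) / y) :=
      Real.arctan_mono (by gcongr; simp)
    have h4 : Real.arctan ((-(N : ℝ) + (k + 1)) / y) ≤ 0 :=
      Real.arctan_le_zero.2 (div_nonpos_of_nonpos_of_nonneg (by linarith) hy.le)
    unfold imTerm
    linarith
  linarith

lemma tendsto_im_mul_I_atTop :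
    Tendsto (fun y : ℝ => (logGamma (y * I)).im) atTop atTop := by
  obtain ⟨N, hN⟩ := (Real.tendsto_sum_range_one_div_nat_succ_atTop.eventually_ge_atTop
    (Real.eulerMascheroniConstant + 1)).exists
  refine tendsto_atTop_mono' atTop ?_
    (tendsto_atTop_add_const_right atTop (-(Real.pi / 2 + N * (Real.pi / 2))) tendsto_id)
  filter_upwards [eventually_gt_atTop 0] with y hy
  have him := im_add_mul_I hy 0
  rw [ofReal_zero, zero_add, zero_div, Real.arctan_zero] at him
  rw [him, id]
  have h1 := (summable_imTerm hy 0).sum_le_tsum (Finset.range N)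
    fun k _ => imTerm_nonneg le_rfl hy k
  have h2 : y * (∑ k ∈ Finset.range N, 1 / ((k : ℝ) + 1)) - N * (Real.pi / 2)
      ≤ ∑ k ∈ Finset.range N, imTerm y k 0 := by
    have : N * (Real.pi / 2) = ∑ k ∈ Finset.range N, Real.pi / 2 := by simp
    rw [this, Finset.mul_sum, ← Finset.sum_sub_distrib]
    refine Finset.sum_le_sum fun k _ => ?_
    have h3 : 0 ≤ Real.arctan ((0 + ((k : ℝ) + 1)) / y) :=
      Real.arctan_nonneg.2 (by positivity)
    rw [imTerm, mul_one_div]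
    linarith
  nlinarith

end logGamma

/-- For each fixed `y > 0`, the map `x ↦ Im L(x + iy)` is a strictly
increasing bijection from `ℝ` onto `ℝ`.  Moreover `Im L(iy) → +∞` as `y → +∞`. -/
theorem im_logGamma_strictMono_bijective_and_tendsto :
    (∀ y : ℝ, 0 < y →
      StrictMono (fun x : ℝ => (logGamma (x + y * I)).im) ∧
      Function.Bijective (fun x : ℝ => (logGamma (x + y * I)).im)) ∧
    Tendsto (fun y : ℝ => (logGamma (y * I)).im) atTop atTop :=
  ⟨fun _ hy => ⟨logGamma.strictMono_im hy, (logGamma.strictMono_im hy).injective,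
    (logGamma.continuous_im hy).surjective (logGamma.tendsto_im_atTop hy)
      (logGamma.tendsto_im_atBot hy)⟩, logGamma.tendsto_im_mul_I_atTop⟩
end

section
/- The function L is injective on the open upper half plane ℂ₊, and its image is the comb domain L(ℂ₊) = ℂ ∖ ⋃_{k=0}^∞ { x − i k π : x ∈ ℝ, x ≥ log|Γ(x_k)| }. -/
open Complex

open Filter Topology

/-- The closed upper half plane without the poles of `Γ`. -/
def closedUpperHalfPlaneMinusPoles : Set ℂ := {z | 0 ≤ z.im ∧ ∀ n : ℕ, z + n ≠ 0}

local notation "ℍ₀" => closedUpperHalfPlaneMinusPoles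

lemma mem_of_im_pos {z : ℂ} (hz : 0 < z.im) : z ∈ ℍ₀ := by
  refine ⟨hz.le, fun n h => ?_⟩
  have := congrArg Complex.im h
  simp at this
  exact hz.ne' this

lemma mem_of_re_pos {z : ℂ} (hz : 0 ≤ z.im) (hz' : 0 < z.re) : z ∈ ℍ₀ := by
  refine ⟨hz, fun n h => ?_⟩
  have := congrArg Complex.re h
  simp at this
  have : (0 : ℝ) ≤ n := n.cast_nonneg
  linarith

lemma add_natCast_mem {z : ℂ} (hz : z ∈ ℍ₀) (n : ℕ) : z + n ∈ ℍ₀ := by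
  refine ⟨by simpa using hz.1, fun m h => hz.2 (n + m) ?_⟩
  rw [← h]; push_cast; ring

lemma add_one_mem {z : ℂ} (hz : z ∈ ℍ₀) : z + 1 ∈ ℍ₀ := by
  simpa using add_natCast_mem hz 1

lemma ne_zero_of_mem {z : ℂ} (hz : z ∈ ℍ₀) : z ≠ 0 := by
  simpa using hz.2 0

/-- The terms of the series defining `logGamma` are summable at every point. -/
lemma summable_log_one_add_div_sub (z : ℂ) :
    Summable fun k : ℕ => Complex.log (1 + z / (k + 1)) - z / (k + 1) := by
  have hs : Summable fun k : ℕ => ‖z‖ ^ 2 * (1 / ((k + 1 : ℕ) : ℝ) ^ 2) :=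
    ((summable_nat_add_iff 1).2 (Real.summable_one_div_nat_pow.2 one_lt_two)).mul_left _
  refine Summable.of_norm_bounded_eventually_nat hs ?_
  filter_upwards [eventually_ge_atTop ⌈2 * ‖z‖⌉₊] with k hk
  have hk' : 2 * ‖z‖ ≤ k := Nat.ceil_le.1 hk
  have hk0 : (0 : ℝ) < (k : ℝ) + 1 := by positivity
  have hn : ‖z / ((k : ℂ) + 1)‖ = ‖z‖ / (k + 1) := by
    rw [norm_div]
    congr 1
    exact_mod_cast Complex.norm_natCast (k + 1)
  have hle : ‖z‖ / ((k : ℝ) + 1) ≤ 1 / 2 := by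
    rw [div_le_iff₀ hk0]; linarith
  have hinv : (1 - ‖z / ((k : ℂ) + 1)‖)⁻¹ ≤ 2 := by
    rw [hn]
    calc (1 - ‖z‖ / ((k : ℝ) + 1))⁻¹ ≤ (1 / 2)⁻¹ := by
          apply inv_anti₀ <;> linarith
      _ = 2 := by norm_num
  refine (Complex.norm_log_one_add_sub_self_le (by rw [hn]; linarith)).trans ?_
  calc ‖z / ((k : ℂ) + 1)‖ ^ 2 * (1 - ‖z / ((k : ℂ) + 1)‖)⁻¹ / 2
      ≤ ‖z / ((k : ℂ) + 1)‖ ^ 2 * 2 / 2 := by gcongr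
    _ = ‖z‖ ^ 2 * (1 / ((k + 1 : ℕ) : ℝ) ^ 2) := by
      rw [hn]; push_cast; field_simp

lemma one_add_div_mem_slitPlane {z : ℂ} (hz : 0 < z.re) (k : ℕ) :
    1 + z / ((k : ℂ) + 1) ∈ Complex.slitPlane := by
  left
  have h : z / ((k : ℂ) + 1) = z / (((k : ℝ) + 1 : ℝ) : ℂ) := by push_cast; rfl
  rw [h, Complex.add_re, Complex.div_ofReal_re]
  have : 0 < z.re / ((k : ℝ) + 1) := by positivity
  simp; linarith

/-- `logGamma` is holomorphic on the right half plane. -/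
lemma differentiableAt_logGamma_of_re_pos {z : ℂ} (hz : 0 < z.re) :
    DifferentiableAt ℂ logGamma z := by
  set t : Set ℂ := {w | 0 < w.re} ∩ Metric.ball 0 (‖z‖ + 1)
  have ht : IsOpen t := (isOpen_lt continuous_const Complex.continuous_re).inter Metric.isOpen_ball
  have hconv : Convex ℝ t := (convex_halfSpace_re_gt 0).inter (convex_ball _ _)
  have hzt : z ∈ t := ⟨hz, by simp⟩
  have hs : Summable fun k : ℕ => (‖z‖ + 1) * (1 / ((k + 1 : ℕ) : ℝ) ^ 2) :=
    ((summable_nat_add_iff 1).2 (Real.summable_one_div_nat_pow.2 one_lt_two)).mul_left _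
  have hk0 (k : ℕ) : (k : ℂ) + 1 ≠ 0 := Nat.cast_add_one_ne_zero k
  have hsum : HasDerivAt (fun w : ℂ => ∑' k : ℕ, (Complex.log (1 + w / (k + 1)) - w / (k + 1)))
      (∑' k : ℕ, ((1 / ((k : ℂ) + 1)) / (1 + z / (k + 1)) - 1 / (k + 1))) z := by
    refine hasDerivAt_tsum_of_isPreconnected
      (g' := fun (k : ℕ) (w : ℂ) => (1 / ((k : ℂ) + 1)) / (1 + w / (k + 1)) - 1 / (k + 1))
      hs ht hconv.isPreconnected
      (fun k w hw => ?_) (fun k w hw => ?_) hzt (summable_log_one_add_div_sub z) hzt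
    · have h1 : HasDerivAt (fun w : ℂ => w / ((k : ℂ) + 1)) (1 / ((k : ℂ) + 1)) w :=
        (hasDerivAt_id w).div_const _
      exact ((h1.const_add 1).clog (one_add_div_mem_slitPlane hw.1 k)).sub h1
    · have hwk : w + ((k : ℂ) + 1) ≠ 0 := by
        intro h
        have h2 := congrArg Complex.re h
        simp at h2
        have h3 : 0 < w.re := hw.1
        have : (0 : ℝ) ≤ k := k.cast_nonneg
        linarith
      have hne : 1 + w / ((k : ℂ) + 1) ≠ 0 := Complex.slitPlane_ne_zero
        (one_add_div_mem_slitPlane hw.1 k)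
      have heq : (1 / ((k : ℂ) + 1)) / (1 + w / (k + 1)) - 1 / (k + 1)
          = -w / ((w + (k + 1)) * (k + 1)) := by
        have := hk0 k
        have : (k : ℂ) + 1 + w ≠ 0 := by rwa [add_comm]
        field_simp
        ring
      have hnk : ‖(k : ℂ) + 1‖ = (k : ℝ) + 1 := by exact_mod_cast Complex.norm_natCast (k + 1)
      have hge : (k : ℝ) + 1 ≤ ‖w + ((k : ℂ) + 1)‖ := by
        refine le_trans ?_ (Complex.re_le_norm _)
        have h3 : 0 < w.re := hw.1
        simp; linarith
      have hwn : ‖w‖ ≤ ‖z‖ + 1 := by simpa using (Metric.mem_ball.1 hw.2).le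
      rw [heq, norm_div, norm_neg, norm_mul, hnk, mul_one_div]
      push_cast
      rw [sq]
      gcongr
  have hlog : DifferentiableAt ℂ Complex.log z := differentiableAt_log (Or.inl hz)
  exact (((differentiableAt_const _).mul differentiableAt_id).sub hlog).sub hsum.differentiableAt

/-- The finite approximations of `logGamma`. -/
noncomputable def logGammaApprox (z : ℂ) (n : ℕ) : ℂ :=
  z * ((harmonic n : ℝ) - Real.eulerMascheroniConstant : ℝ) + (Real.log (n.factorial : ℝ) : ℝ) -
    ∑ j ∈ Finset.range (n + 1), Complex.log (z + j)

lemma log_one_add_div {z : ℂ} (k : ℕ) (hz : z + (k + 1) ≠ 0) :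
    Complex.log (1 + z / (k + 1)) = Complex.log (z + (k + 1)) - (Real.log (k + 1) : ℝ) := by
  have hk : (0 : ℝ) < (k : ℝ) + 1 := by positivity
  have h : z + (k + 1) = (((k : ℝ) + 1 : ℝ) : ℂ) * (1 + z / (k + 1)) := by
    have : (k : ℂ) + 1 ≠ 0 := Nat.cast_add_one_ne_zero k
    push_cast; field_simp; ring
  have hne : 1 + z / ((k : ℂ) + 1) ≠ 0 := fun h0 => hz (by rw [h, h0, mul_zero])
  rw [h, Complex.log_ofReal_mul hk hne]
  ring

lemma logGammaApprox_eq {z : ℂ} (hz : z ∈ ℍ₀) (n : ℕ) :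
    logGammaApprox z n = -(Real.eulerMascheroniConstant : ℂ) * z - Complex.log z -
      ∑ k ∈ Finset.range n, (Complex.log (1 + z / (k + 1)) - z / (k + 1)) := by
  induction n with
  | zero => simp [logGammaApprox]; ring
  | succ n ih =>
    rw [Finset.sum_range_succ, ← sub_sub, ← ih, log_one_add_div n (by simpa using hz.2 (n + 1))]
    simp only [logGammaApprox]
    rw [Finset.sum_range_succ _ (n + 1), harmonic_succ, Nat.factorial_succ]
    push_cast
    rw [Real.log_mul (by positivity) (by positivity)]
    push_cast
    ring

lemma tendsto_logGammaApprox {z : ℂ} (hz : z ∈ ℍ₀) :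
    Tendsto (logGammaApprox z) atTop (𝓝 (logGamma z)) := by
  have h := (summable_log_one_add_div_sub z).hasSum.tendsto_sum_nat
  exact (tendsto_const_nhds.sub h).congr fun n => (logGammaApprox_eq hz n).symm

/-- The functional equation of `logGamma`. -/
lemma logGamma_add_one {z : ℂ} (hz : z ∈ ℍ₀) : logGamma (z + 1) = logGamma z + Complex.log z := by
  have h1 := tendsto_logGammaApprox (add_one_mem hz)
  have h2 := (tendsto_logGammaApprox hz).add_const (Complex.log z)
  refine tendsto_nhds_unique h1 ?_
  have hdiff : Tendsto (fun n : ℕ => (((harmonic n : ℝ) - Real.log n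
      - Real.eulerMascheroniConstant : ℝ) : ℂ) - Complex.log (1 + (z + 1) / n)) atTop (𝓝 0) := by
    have ha : Tendsto (fun n : ℕ => (((harmonic n : ℝ) - Real.log n
      - Real.eulerMascheroniConstant : ℝ) : ℂ)) atTop (𝓝 0) := by
      have := (Real.tendsto_harmonic_sub_log.sub_const Real.eulerMascheroniConstant)
      rw [sub_self] at this
      exact_mod_cast (Complex.continuous_ofReal.tendsto 0).comp this
    have hb : Tendsto (fun n : ℕ => Complex.log (1 + (z + 1) / n)) atTop (𝓝 0) := by
      have h0 : Tendsto (fun n : ℕ => 1 + (z + 1) / (n : ℂ)) atTop (𝓝 1) := by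
        simpa using (tendsto_const_div_atTop_nhds_zero_nat (z + 1)).const_add (1 : ℂ)
      have h := (continuousAt_clog Complex.one_mem_slitPlane).tendsto.comp h0
      simpa [Function.comp_def] using h
    simpa using ha.sub hb
  have h3 := h2.add hdiff
  rw [add_zero] at h3
  refine h3.congr' ?_
  filter_upwards [eventually_ge_atTop 1] with n hn
  obtain ⟨m, rfl⟩ : ∃ m, n = m + 1 := ⟨n - 1, by omega⟩
  have hne : z + 1 + ((m : ℂ) + 1) ≠ 0 := by
    simpa using (add_one_mem hz).2 (m + 1)
  have hl := log_one_add_div (z := z + 1) m hne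
  push_cast
  rw [hl]
  simp only [logGammaApprox]
  rw [Finset.sum_range_succ (fun j : ℕ => Complex.log (z + 1 + j)),
    Finset.sum_range_succ' (fun j : ℕ => Complex.log (z + j))]
  have : ∑ j ∈ Finset.range (m + 1), Complex.log (z + 1 + j)
      = ∑ j ∈ Finset.range (m + 1), Complex.log (z + (j + 1 : ℕ)) :=
    Finset.sum_congr rfl fun j _ => by push_cast; ring_nf
  rw [this]
  push_cast
  simp only [add_zero]
  ring

/-- `logGamma` is a logarithm of `Γ`. -/
lemma exp_logGamma {z : ℂ} (hz : z ∈ ℍ₀) : Complex.exp (logGamma z) = Complex.Gamma z := by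
  have h1 := (Complex.continuous_exp.tendsto _).comp (tendsto_logGammaApprox hz)
  refine tendsto_nhds_unique h1 ?_
  have ha : Tendsto (fun n : ℕ => Complex.exp (z * (((harmonic n : ℝ) - Real.log n
      - Real.eulerMascheroniConstant : ℝ) : ℂ))) atTop (𝓝 1) := by
    have := (Real.tendsto_harmonic_sub_log.sub_const Real.eulerMascheroniConstant)
    rw [sub_self] at this
    have h := ((Complex.continuous_ofReal.tendsto 0).comp this).const_mul z
    have h' := (Complex.continuous_exp.tendsto _).comp h
    simpa [Function.comp_def] using h'
  have h2 := ha.mul (Complex.GammaSeq_tendsto_Gamma z)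
  rw [one_mul] at h2
  refine h2.congr' ?_
  filter_upwards [eventually_ge_atTop 1] with n hn
  have hn0 : (n : ℂ) ≠ 0 := by exact_mod_cast (by omega : n ≠ 0)
  have hprod : ∏ j ∈ Finset.range (n + 1), (z + j)
      = Complex.exp (∑ j ∈ Finset.range (n + 1), Complex.log (z + j)) := by
    rw [Complex.exp_sum]
    exact Finset.prod_congr rfl fun j _ => (Complex.exp_log (hz.2 j)).symm
  have hfac : ((n.factorial : ℕ) : ℂ) = Complex.exp ((Real.log (n.factorial : ℝ) : ℝ) : ℂ) := by
    rw [← Complex.ofReal_exp, Real.exp_log (by positivity)]; simp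
  have hpow : (n : ℂ) ^ z = Complex.exp (z * (Real.log n : ℝ)) := by
    rw [Complex.cpow_def_of_ne_zero hn0, mul_comm, Complex.natCast_log]
  rw [Complex.GammaSeq, hprod, hfac, hpow, ← Complex.exp_add, ← Complex.exp_sub, ← Complex.exp_add]
  simp only [Function.comp, logGammaApprox]
  congr 1
  push_cast
  ring

lemma differentiableAt_logGamma {z : ℂ} (hz : 0 < z.im) : DifferentiableAt ℂ logGamma z := by
  suffices h : ∀ (n : ℕ) (z : ℂ), 0 < z.im → -(n : ℝ) < z.re → DifferentiableAt ℂ logGamma z by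
    obtain ⟨n, hn⟩ := exists_nat_gt (-z.re)
    exact h n z hz (by linarith)
  intro n
  induction n with
  | zero => exact fun z _ hz' => differentiableAt_logGamma_of_re_pos (by simpa using hz')
  | succ n ih =>
    intro z hz hz'
    push_cast at hz'
    have h1 : DifferentiableAt ℂ logGamma (z + 1) := ih _ (by simpa using hz) (by simp; linarith)
    have h2 : DifferentiableAt ℂ (fun w => logGamma (w + 1) - Complex.log w) z :=
      (h1.comp (f := fun w => w + 1) z (differentiableAt_id.add_const 1)).fun_sub
        (differentiableAt_log (Or.inr hz.ne'))
    refine h2.congr_of_eventuallyEq ?_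
    filter_upwards [(isOpen_lt continuous_const Complex.continuous_im).mem_nhds hz] with w hw
    rw [logGamma_add_one (mem_of_im_pos hw)]
    ring

lemma continuousWithinAt_clog {z : ℂ} (hz0 : z ≠ 0) :
    ContinuousWithinAt Complex.log {z : ℂ | 0 ≤ z.im} z := by
  by_cases h : z ∈ Complex.slitPlane
  · exact (continuousAt_clog h).continuousWithinAt
  · rw [Complex.mem_slitPlane_iff] at h
    push Not at h
    refine Complex.continuousWithinAt_log_of_re_neg_of_im_zero
      (lt_of_le_of_ne h.1 fun h0 => hz0 (Complex.ext h0 h.2)) h.2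

/-- `logGamma` extends continuously to the real line without the poles. -/
lemma continuousOn_logGamma : ContinuousOn logGamma ℍ₀ := by
  suffices h : ∀ (n : ℕ), ∀ z ∈ ℍ₀, -(n : ℝ) < z.re → ContinuousWithinAt logGamma ℍ₀ z by
    intro z hz
    obtain ⟨n, hn⟩ := exists_nat_gt (-z.re)
    exact h n z hz (by linarith)
  intro n
  induction n with
  | zero => exact fun z _ hz' => (differentiableAt_logGamma_of_re_pos
      (by simpa using hz')).continuousAt.continuousWithinAt
  | succ n ih =>
    intro z hz hz'
    push_cast at hz'
    have h1 : ContinuousWithinAt logGamma ℍ₀ (z + 1) := ih _ (add_one_mem hz) (by simp; linarith)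
    have h2 : ContinuousWithinAt (fun w => logGamma (w + 1) - Complex.log w) ℍ₀ z := by
      refine ContinuousWithinAt.sub ?_
        ((continuousWithinAt_clog (ne_zero_of_mem hz)).mono fun w hw => hw.1)
      exact h1.comp (f := fun w => w + 1) (continuous_add_const 1).continuousWithinAt
        fun w hw => add_one_mem hw
    refine h2.congr (fun w hw => ?_) ?_
    · rw [logGamma_add_one hw]; ring
    · rw [logGamma_add_one hz]; ring

/-- The divided differences of `log` on the upper half plane have negative imaginary part. -/
lemma im_log_sub_div_neg {a b : ℂ} (ha : 0 < a.im) (hb : 0 < b.im) (hab : a ≠ b) :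
    ((Complex.log a - Complex.log b) / (a - b)).im < 0 := by
  have hab' : a - b ≠ 0 := sub_ne_zero.2 hab
  have him (t : ℝ) (ht : t ∈ Set.Icc (0 : ℝ) 1) : 0 < (b + t * (a - b)).im := by
    have : (b + t * (a - b)).im = (1 - t) * b.im + t * a.im := by simp; ring
    rw [this]
    rcases ht.1.eq_or_lt with h | h
    · rw [← h]; simpa using hb
    · have : 0 ≤ (1 - t) * b.im := mul_nonneg (by linarith [ht.2]) hb.le
      have : 0 < t * a.im := mul_pos h ha
      linarith
  have hder (t : ℝ) (ht : t ∈ Set.Icc (0 : ℝ) 1) :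
      HasDerivAt (fun t : ℝ => (Complex.log (b + t * (a - b)) / (a - b)).im)
        ((1 / (b + t * (a - b))).im) t := by
    have h1 : HasDerivAt (fun t : ℝ => b + (t : ℂ) * (a - b)) (a - b) t := by
      simpa using ((Complex.ofRealCLM.hasDerivAt (x := t)).mul_const (a - b)).const_add b
    have h2 := (h1.clog_real (Or.inr (him t ht).ne')).div_const (a - b)
    have h3 := Complex.imCLM.hasFDerivAt.comp_hasDerivAt t h2
    have heq : (a - b) / (b + t * (a - b)) / (a - b) = 1 / (b + t * (a - b)) := by
      field_simp
    rw [heq] at h3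
    exact h3
  have hanti : StrictAntiOn (fun t : ℝ => (Complex.log (b + t * (a - b)) / (a - b)).im)
      (Set.Icc 0 1) := by
    refine strictAntiOn_of_deriv_neg (convex_Icc 0 1)
      (fun t ht => (hder t ht).continuousAt.continuousWithinAt) fun t ht => ?_
    rw [interior_Icc] at ht
    have ht' := Set.Ioo_subset_Icc_self ht
    rw [(hder t ht').deriv, one_div, Complex.inv_im]
    have h0 : b + t * (a - b) ≠ 0 := fun h => (him t ht').ne' (by rw [h]; simp)
    have := Complex.normSq_pos.2 h0
    exact div_neg_of_neg_of_pos (by linarith [him t ht']) this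
  have := hanti (by simp) (by simp) (zero_lt_one (α := ℝ))
  simp at this
  rw [sub_div, Complex.sub_im]
  linarith

lemma injOn_logGamma : Set.InjOn logGamma {z : ℂ | 0 < z.im} := by
  intro a ha b hb hL
  by_contra hab
  have hab' : a - b ≠ 0 := sub_ne_zero.2 hab
  have ha : 0 < a.im := ha
  have hb : 0 < b.im := hb
  have hlim : Tendsto (fun n => ((logGammaApprox a n - logGammaApprox b n) / (a - b)).im) atTop
      (𝓝 0) := by
    have h := ((tendsto_logGammaApprox (mem_of_im_pos ha)).sub
      (tendsto_logGammaApprox (mem_of_im_pos hb))).div_const (a - b)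
    rw [hL, sub_self, zero_div] at h
    simpa [Function.comp_def] using (Complex.continuous_im.tendsto _).comp h
  refine absurd (ge_of_tendsto' hlim fun n => ?_)
    (not_le.2 (neg_pos.2 (im_log_sub_div_neg ha hb hab)))
  have heq : (logGammaApprox a n - logGammaApprox b n) / (a - b) =
      (((harmonic n : ℝ) - Real.eulerMascheroniConstant : ℝ) : ℂ) -
        ∑ j ∈ Finset.range (n + 1),
          (Complex.log (a + j) - Complex.log (b + j)) / (a + j - (b + j)) := by
    have : ∀ j : ℕ, a + j - (b + j) = a - b := fun j => by ring
    simp only [this]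
    rw [← Finset.sum_div, Finset.sum_sub_distrib]
    simp only [logGammaApprox]
    field_simp
    ring
  rw [heq, Complex.sub_im, Complex.ofReal_im, zero_sub, Complex.im_sum, Finset.sum_range_succ']
  have hneg : ∑ j ∈ Finset.range n, ((Complex.log (a + (j + 1 : ℕ)) -
      Complex.log (b + (j + 1 : ℕ))) / (a + (j + 1 : ℕ) - (b + (j + 1 : ℕ)))).im ≤ 0 :=
    Finset.sum_nonpos fun j _ => (im_log_sub_div_neg (by simpa using ha) (by simpa using hb)
      fun h => hab (add_right_cancel h)).le
  simp only [Nat.cast_zero, add_zero]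
  linarith

lemma isOpen_image_logGamma {s : Set ℂ} (hs : IsOpen s) (hsub : s ⊆ {z : ℂ | 0 < z.im}) :
    IsOpen (logGamma '' s) := by
  have hopen : IsOpen {z : ℂ | 0 < z.im} := isOpen_lt continuous_const Complex.continuous_im
  have han : AnalyticOnNhd ℂ logGamma {z : ℂ | 0 < z.im} :=
    DifferentiableOn.analyticOnNhd
      (fun z hz => (differentiableAt_logGamma hz).differentiableWithinAt) hopen
  rcases han.is_constant_or_isOpen (convex_halfSpace_im_gt 0).isPreconnected with ⟨w, hw⟩ | h
  · have h1 : (0 : ℝ) < Complex.I.im := by simp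
    have h2 : (0 : ℝ) < (2 * Complex.I).im := by simp
    have := injOn_logGamma h1 h2 ((hw _ h1).trans (hw _ h2).symm)
    have := congrArg Complex.im this
    norm_num at this
  · exact h s hsub hs

lemma arg_one_add_le {w : ℂ} (hre : 0 ≤ w.re) (him : 0 ≤ w.im) : Complex.arg (1 + w) ≤ w.im := by
  have hre' : 0 < (1 + w).re := by simp; linarith
  have hlt : Complex.arg (1 + w) < Real.pi / 2 :=
    (abs_lt.1 (Complex.abs_arg_lt_pi_div_two_iff.2 (Or.inl hre'))).2
  have hnn : 0 ≤ Complex.arg (1 + w) := Complex.arg_nonneg_iff.2 (by simpa using him)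
  calc Complex.arg (1 + w) ≤ Real.tan (Complex.arg (1 + w)) := Real.le_tan hnn hlt
    _ = w.im / (1 + w.re) := by rw [Complex.tan_arg]; simp
    _ ≤ w.im := div_le_self him (by linarith)

/-- A lower bound for `Im logGamma` in the closed first quadrant. -/
lemma le_im_logGamma_of_re_nonneg {z : ℂ} (hre : 0 ≤ z.re) (him : 0 ≤ z.im) (n : ℕ) :
    z.im * ((harmonic n : ℝ) - Real.eulerMascheroniConstant) - (n + 1) * (Real.pi / 2) ≤
      (logGamma z).im := by
  have hs := summable_log_one_add_div_sub z
  have hcast (k : ℕ) : z / ((k : ℂ) + 1) = z / (((k : ℝ) + 1 : ℝ) : ℂ) := by push_cast; rfl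
  have him' (k : ℕ) : (z / ((k : ℂ) + 1)).im = z.im / (k + 1) := by
    rw [hcast, Complex.div_ofReal_im]
  have hre' (k : ℕ) : (z / ((k : ℂ) + 1)).re = z.re / (k + 1) := by
    rw [hcast, Complex.div_ofReal_re]
  have hpi {w : ℂ} (hw : 0 ≤ w.re) : w.arg ≤ Real.pi / 2 :=
    (abs_le.1 (Complex.abs_arg_le_pi_div_two_iff.2 hw)).2
  have htsum : (∑' k : ℕ, (Complex.log (1 + z / (k + 1)) - z / (k + 1))).im ≤
      ∑ k ∈ Finset.range n, (Real.pi / 2 - z.im / (k + 1)) := by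
    rw [Complex.im_tsum hs, ← Summable.sum_add_tsum_nat_add n (Complex.hasSum_im hs.hasSum).summable]
    have h1 : ∑' k : ℕ, (Complex.log (1 + z / ((k + n : ℕ) + 1)) - z / ((k + n : ℕ) + 1)).im ≤ 0 :=
      tsum_nonpos fun k => by
        rw [Complex.sub_im, Complex.log_im, sub_nonpos]
        refine arg_one_add_le ?_ ?_
        · rw [hre']; positivity
        · rw [him']; positivity
    have h2 : ∑ k ∈ Finset.range n, (Complex.log (1 + z / (k + 1)) - z / (k + 1)).im ≤
        ∑ k ∈ Finset.range n, (Real.pi / 2 - z.im / (k + 1)) :=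
      Finset.sum_le_sum fun k _ => by
        rw [Complex.sub_im, Complex.log_im, him']
        gcongr
        refine hpi ?_
        rw [Complex.add_re, hre', Complex.one_re]
        positivity
    linarith
  have hharm : ∑ k ∈ Finset.range n, (Real.pi / 2 - z.im / (k + 1)) =
      n * (Real.pi / 2) - z.im * (harmonic n : ℝ) := by
    rw [Finset.sum_sub_distrib, Finset.sum_const, Finset.card_range, nsmul_eq_mul, harmonic]
    push_cast
    rw [Finset.mul_sum]
    rfl
  have harg : z.arg ≤ Real.pi / 2 := hpi hre
  have hL : (logGamma z).im = -Real.eulerMascheroniConstant * z.im - z.arg -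
      (∑' k : ℕ, (Complex.log (1 + z / (k + 1)) - z / (k + 1))).im := by
    simp [logGamma, Complex.log_im]
  rw [hL]
  linarith

lemma norm_Gamma_le_Gamma_re {z : ℂ} (hz : 0 < z.re) : ‖Complex.Gamma z‖ ≤ Real.Gamma z.re := by
  rw [Complex.Gamma_eq_integral hz, Complex.GammaIntegral, Real.Gamma_eq_integral hz]
  refine (MeasureTheory.norm_integral_le_integral_norm _).trans (le_of_eq ?_)
  refine MeasureTheory.setIntegral_congr_fun measurableSet_Ioi fun x hx => ?_
  have hx : 0 < x := hx
  rw [norm_mul, Complex.norm_cpow_eq_rpow_re_of_pos hx,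
    Complex.norm_real, Real.norm_of_nonneg (Real.exp_pos _).le]
  simp

lemma norm_Gamma_le_norm_Gamma_add_natCast {z : ℂ} (hz : 1 ≤ z.im) (n : ℕ) :
    ‖Complex.Gamma z‖ ≤ ‖Complex.Gamma (z + n)‖ := by
  induction n with
  | zero => simp
  | succ n ih =>
    have him : (z + n).im = z.im := by simp
    have h1 : 1 ≤ ‖z + n‖ := hz.trans (him ▸ (Complex.im_le_norm (z + n)))
    have h0 : z + n ≠ 0 := norm_pos_iff.1 (by linarith)
    have : z + (n + 1 : ℕ) = z + n + 1 := by push_cast; ring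
    rw [this, Complex.Gamma_add_one _ h0, norm_mul]
    exact ih.trans (le_mul_of_one_le_left (norm_nonneg _) h1)

/-- `Γ` decays upwards in the half plane `Re z ≤ 1`. -/
lemma norm_Gamma_le_two_div_im {z : ℂ} (hre : z.re ≤ 1) (him : 1 ≤ z.im) :
    ‖Complex.Gamma z‖ ≤ 2 / z.im := by
  set n := ⌈1 - z.re⌉₊
  have h1 : 1 - z.re ≤ n := Nat.le_ceil _
  have h2 : (n : ℝ) < 1 - z.re + 1 := Nat.ceil_lt_add_one (by linarith)
  have him' : (z + n).im = z.im := by simp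
  have hre' : (z + n + 1).re = z.re + n + 1 := by simp
  have hle : z.im ≤ ‖z + n‖ := him' ▸ (Complex.im_le_norm (z + n))
  have h0 : z + n ≠ 0 := norm_pos_iff.1 (by linarith)
  have hG : ‖Complex.Gamma (z + n + 1)‖ ≤ 2 := by
    refine (norm_Gamma_le_Gamma_re (by rw [hre']; linarith)).trans ?_
    have h3 : Real.Gamma 3 = 2 := by
      have := Real.Gamma_nat_eq_factorial 2
      rw [show ((2 : ℕ) : ℝ) + 1 = 3 by norm_num] at this
      rw [this]
      norm_num [Nat.factorial]
    rw [← h3, hre']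
    exact Real.Gamma_strictMonoOn_Ici.monotoneOn (by simp only [Set.mem_Ici]; linarith)
      (by simp only [Set.mem_Ici]; norm_num) (by linarith)
  rw [Complex.Gamma_add_one _ h0, norm_mul] at hG
  refine (norm_Gamma_le_norm_Gamma_add_natCast him n).trans ?_
  rw [le_div_iff₀ (by linarith)]
  nlinarith [norm_nonneg (Complex.Gamma (z + n))]

lemma norm_Gamma_eq_exp_re {z : ℂ} (hz : z ∈ ℍ₀) :
    ‖Complex.Gamma z‖ = Real.exp (logGamma z).re := by
  rw [← exp_logGamma hz, Complex.norm_exp]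

/-- `logGamma` is large at points with large imaginary part. -/
lemma exists_im_le_of_norm_logGamma_le (M : ℝ) :
    ∃ Y, ∀ z : ℂ, 0 < z.im → ‖logGamma z‖ ≤ M → z.im ≤ Y := by
  obtain ⟨n, hn⟩ : ∃ n : ℕ, Real.eulerMascheroniConstant + 1 ≤ (harmonic n : ℝ) := by
    have h : Tendsto (fun n : ℕ => (harmonic n : ℝ)) atTop atTop := by
      have h1 := Real.tendsto_log_atTop.comp tendsto_natCast_atTop_atTop
      have h2 := h1.atTop_add Real.tendsto_harmonic_sub_log
      refine h2.congr fun n => ?_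
      simp
    exact (h.eventually_ge_atTop _).exists
  refine ⟨max (M + (n + 1) * (Real.pi / 2)) (max 1 (2 * Real.exp M)), fun z hz hM => ?_⟩
  rcases le_total 0 z.re with hre | hre
  · refine le_max_of_le_left ?_
    have h1 := le_im_logGamma_of_re_nonneg hre hz.le n
    have h2 := (Complex.im_le_norm _).trans hM
    nlinarith
  · refine le_max_of_le_right ?_
    rcases le_total z.im 1 with h1 | h1
    · exact le_max_of_le_left h1
    · refine le_max_of_le_right ?_
      have h2 := norm_Gamma_le_two_div_im (by linarith) h1
      rw [norm_Gamma_eq_exp_re (mem_of_im_pos hz), le_div_iff₀ hz] at h2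
      have h3 : -M ≤ (logGamma z).re :=
        (abs_le.1 ((Complex.abs_re_le_norm _).trans hM)).1
      have h4 : Real.exp (-M) * z.im ≤ 2 :=
        (mul_le_mul_of_nonneg_right (Real.exp_le_exp.2 h3) hz.le).trans h2
      rw [Real.exp_neg, inv_mul_le_iff₀ (Real.exp_pos M)] at h4
      linarith

lemma im_logGamma_le_im_logGamma_add_one {z : ℂ} (hz : z ∈ ℍ₀) :
    (logGamma z).im ≤ (logGamma (z + 1)).im := by
  rw [logGamma_add_one hz, Complex.add_im, Complex.log_im]
  linarith [Complex.arg_nonneg_iff.2 hz.1]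

lemma im_logGamma_add_pi_div_two_le {z : ℂ} (hz : z ∈ ℍ₀) (hre : z.re ≤ 0) :
    (logGamma z).im + Real.pi / 2 ≤ (logGamma (z + 1)).im := by
  rw [logGamma_add_one hz, Complex.add_im, Complex.log_im]
  have : Real.pi / 2 ≤ z.arg := by
    by_contra! h
    have h0 := Complex.arg_nonneg_iff.2 hz.1
    have : |z.arg| < Real.pi / 2 := abs_lt.2 ⟨by linarith [Real.pi_pos], h⟩
    rcases Complex.abs_arg_lt_pi_div_two_iff.1 this with h | h
    · linarith
    · exact ne_zero_of_mem hz h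
  linarith

lemma re_logGamma_add_log_two_le {z : ℂ} (hz : z ∈ ℍ₀) (hre : 2 ≤ z.re) :
    (logGamma z).re + Real.log 2 ≤ (logGamma (z + 1)).re := by
  rw [logGamma_add_one hz, Complex.add_re, Complex.log_re]
  gcongr
  exact hre.trans (Complex.re_le_norm z)

/-- In a horizontal strip, `logGamma` is large far away from the imaginary axis. -/
lemma exists_abs_re_le_of_norm_logGamma_le (M Y : ℝ) :
    ∃ X, ∀ z : ℂ, 0 < z.im → z.im ≤ Y → ‖logGamma z‖ ≤ M → |z.re| ≤ X := by
  have hK : IsCompact (Set.Icc (2 : ℝ) 3 ×ℂ Set.Icc (0 : ℝ) Y) := isCompact_Icc.reProdIm isCompact_Icc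
  obtain ⟨C, hC⟩ := hK.exists_bound_of_continuousOn (f := logGamma)
    (continuousOn_logGamma.mono fun z hz => mem_of_re_pos hz.2.1 (by linarith [hz.1.1]))
  have hright (n : ℕ) : ∀ z : ℂ, 0 < z.im → z.im ≤ Y → 2 ≤ z.re → z.re ≤ 3 →
      -C + n * Real.log 2 ≤ (logGamma (z + n)).re := by
    intro z h0 hY h2 h3
    induction n with
    | zero =>
      have := (Complex.abs_re_le_norm _).trans (hC z ⟨⟨h2, h3⟩, ⟨h0.le, hY⟩⟩)
      simpa using (abs_le.1 this).1
    | succ n ih =>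
      have := re_logGamma_add_log_two_le (add_natCast_mem (mem_of_im_pos h0) n)
        (by simp; linarith [(n.cast_nonneg : (0 : ℝ) ≤ n)])
      push_cast
      rw [← add_assoc]
      linarith
  have hleft (n : ℕ) : ∀ z : ℂ, 0 < z.im → z.im ≤ Y → -1 - (n : ℝ) ≤ z.re → z.re ≤ -n →
      (logGamma z).im ≤ C - n * (Real.pi / 2) := by
    induction n with
    | zero =>
      intro z h0 hY h1 h2
      have hz := mem_of_im_pos h0
      simp only [Nat.cast_zero, sub_zero, neg_zero] at h1 h2
      have h3 : ‖logGamma (z + 1 + 1 + 1)‖ ≤ C := hC _ ⟨⟨by simp; linarith, by simp; linarith⟩,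
        ⟨by simpa using h0.le, by simpa using hY⟩⟩
      have a1 := im_logGamma_le_im_logGamma_add_one hz
      have a2 := im_logGamma_le_im_logGamma_add_one (add_one_mem hz)
      have a3 := im_logGamma_le_im_logGamma_add_one (add_one_mem (add_one_mem hz))
      have a4 := (Complex.im_le_norm _).trans h3
      simp only [Nat.cast_zero, zero_mul, sub_zero]
      linarith
    | succ n ih =>
      intro z h0 hY h1 h2
      push_cast at h1 h2
      have a1 := ih (z + 1) (by simpa using h0) (by simpa using hY) (by simp; linarith)
        (by simp; linarith)
      have a2 := im_logGamma_add_pi_div_two_le (mem_of_im_pos h0)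
        (by linarith [(n.cast_nonneg : (0 : ℝ) ≤ n)])
      push_cast
      linarith
  have hlog : 0 < Real.log 2 := Real.log_pos one_lt_two
  have hpi : 0 < Real.pi / 2 := Real.pi_div_two_pos
  refine ⟨max 3 (max (3 + (M + C) / Real.log 2) (1 + (M + C) / (Real.pi / 2))),
    fun z h0 hY hM => ?_⟩
  rcases le_total |z.re| 3 with h3 | h3
  · exact le_max_of_le_left h3
  refine le_max_of_le_right ?_
  rcases le_total 0 z.re with hre | hre
  · rw [abs_of_nonneg hre] at h3 ⊢
    refine le_max_of_le_left ?_
    set n := ⌊z.re - 2⌋₊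
    have hn1 : (n : ℝ) ≤ z.re - 2 := Nat.floor_le (by linarith)
    have hn2 : z.re - 2 < n + 1 := Nat.lt_floor_add_one _
    have h := hright n (z - n) (by simpa using h0) (by simpa using hY) (by simp; linarith)
      (by simp; linarith)
    rw [sub_add_cancel] at h
    have h' := (Complex.re_le_norm _).trans hM
    have : (n : ℝ) ≤ (M + C) / Real.log 2 := by
      rw [le_div_iff₀ hlog]; linarith
    linarith
  · rw [abs_of_nonpos hre] at h3 ⊢
    refine le_max_of_le_right ?_
    set n := ⌊-z.re⌋₊
    have hn1 : (n : ℝ) ≤ -z.re := Nat.floor_le (by linarith)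
    have hn2 : -z.re < n + 1 := Nat.lt_floor_add_one _
    have h := hleft n z h0 hY (by linarith) (by linarith)
    have h' := (abs_le.1 ((Complex.abs_im_le_norm _).trans hM)).1
    have : (n : ℝ) ≤ (M + C) / (Real.pi / 2) := by
      rw [le_div_iff₀ hpi]; linarith
    linarith

/-- `logGamma` tends to infinity at infinity. -/
lemma exists_norm_le_of_norm_logGamma_le (M : ℝ) :
    ∃ R, ∀ z : ℂ, 0 < z.im → ‖logGamma z‖ ≤ M → ‖z‖ ≤ R := by
  obtain ⟨Y, hY⟩ := exists_im_le_of_norm_logGamma_le M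
  obtain ⟨X, hX⟩ := exists_abs_re_le_of_norm_logGamma_le M Y
  refine ⟨X + Y, fun z h0 hM => (Complex.norm_le_abs_re_add_abs_im z).trans ?_⟩
  rw [abs_of_pos h0]
  exact add_le_add (hX z h0 (hY z h0 hM) hM) (hY z h0 hM)

/-- The `k`-th component of the real line without the poles of `Γ`. -/
def gammaInterval (k : ℕ) : Set ℝ := {t | -(k : ℝ) < t ∧ (k = 0 ∨ t < -(k : ℝ) + 1)}

lemma ofReal_mem_of_mem_gammaInterval {k : ℕ} {t : ℝ} (ht : t ∈ gammaInterval k) :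
    (t : ℂ) ∈ ℍ₀ := by
  refine ⟨by simp, fun n h => ?_⟩
  have h' : t = -(n : ℝ) := by
    have : t + n = 0 := by exact_mod_cast h
    linarith
  obtain ⟨h1, h2⟩ := ht
  rw [h'] at h1 h2
  have h3 : n < k := by exact_mod_cast neg_lt_neg_iff.1 h1
  rcases h2 with rfl | h2
  · omega
  · have : (k : ℝ) < n + 1 := by linarith
    have : k < n + 1 := by exact_mod_cast this
    omega

lemma exists_mem_gammaInterval {t : ℝ} (ht : (t : ℂ) ∈ ℍ₀) : ∃ k, t ∈ gammaInterval k := by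
  rcases lt_or_ge 0 t with h | h
  · exact ⟨0, by simpa using h, Or.inl rfl⟩
  · refine ⟨⌊-t⌋₊ + 1, ?_, Or.inr ?_⟩
    · have := Nat.lt_floor_add_one (-t)
      push_cast
      linarith
    · have h1 : (⌊-t⌋₊ : ℝ) ≤ -t := Nat.floor_le (by linarith)
      have h2 : (⌊-t⌋₊ : ℝ) ≠ -t := fun h => by
        refine ht.2 ⌊-t⌋₊ ?_
        have : t + (⌊-t⌋₊ : ℝ) = 0 := by rw [h]; ring
        exact_mod_cast this
      have := lt_of_le_of_ne h1 h2
      push_cast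
      linarith

lemma im_logGamma_ofReal_of_pos {t : ℝ} (ht : 0 < t) : (logGamma t).im = 0 := by
  have h := (Complex.continuous_im.tendsto _).comp
    (tendsto_logGammaApprox (mem_of_re_pos (z := t) (by simp) (by simpa using ht)))
  refine tendsto_nhds_unique h (tendsto_const_nhds.congr fun n => ?_)
  have : ∀ j : ℕ, (Complex.log ((t : ℂ) + j)).im = 0 := fun j => by
    rw [Complex.log_im, show (t : ℂ) + j = ((t + j : ℝ) : ℂ) by push_cast; rfl]
    exact Complex.arg_ofReal_of_nonneg (by positivity)
  rw [Function.comp, logGammaApprox, Complex.sub_im, Complex.add_im, Complex.im_sum,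
    Finset.sum_eq_zero fun j _ => this j, ← Complex.ofReal_mul, Complex.ofReal_im, Complex.ofReal_im]
  simp

/-- The boundary values of `logGamma` lie on the lines `Im w = -kπ`. -/
lemma im_logGamma_ofReal (k : ℕ) : ∀ t ∈ gammaInterval k, (logGamma t).im = -(k : ℝ) * Real.pi := by
  induction k with
  | zero =>
    intro t ht
    simpa using im_logGamma_ofReal_of_pos (by simpa using ht.1)
  | succ k ih =>
    intro t ht
    have hmem := ofReal_mem_of_mem_gammaInterval ht
    obtain ⟨h1, h2⟩ := ht
    have h2 : t < -((k + 1 : ℕ) : ℝ) + 1 := h2.resolve_left (Nat.succ_ne_zero k)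
    push_cast at h1 h2
    have ht0 : t < 0 := by linarith [(k.cast_nonneg : (0 : ℝ) ≤ k)]
    have h3 := ih (t + 1) ⟨by linarith, Or.inr (by linarith)⟩
    push_cast at h3
    rw [logGamma_add_one hmem, Complex.add_im, Complex.log_im, Complex.arg_ofReal_of_neg ht0] at h3
    push_cast
    linarith

lemma re_logGamma_ofReal {t : ℝ} (ht : (t : ℂ) ∈ ℍ₀) :
    (logGamma t).re = Real.log |Real.Gamma t| := by
  rw [← Real.log_exp (logGamma t).re, ← norm_Gamma_eq_exp_re ht, Complex.Gamma_ofReal,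
    Complex.norm_real, Real.norm_eq_abs]

lemma Real.Gamma_ne_zero_of_mem {t : ℝ} (ht : (t : ℂ) ∈ ℍ₀) : Real.Gamma t ≠ 0 := by
  have : Complex.Gamma t ≠ 0 := by
    rw [← exp_logGamma ht]; exact Complex.exp_ne_zero _
  rw [Complex.Gamma_ofReal] at this
  exact_mod_cast this

lemma Real.continuous_inv_Gamma : Continuous fun t : ℝ => (Real.Gamma t)⁻¹ := by
  have h := Complex.continuous_re.comp
    (Complex.differentiable_one_div_Gamma.continuous.comp Complex.continuous_ofReal)
  refine h.congr fun t => ?_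
  simp [Complex.Gamma_ofReal, ← Complex.ofReal_inv]

lemma Real.differentiableAt_Gamma_of_mem {t : ℝ} (ht : (t : ℂ) ∈ ℍ₀) :
    DifferentiableAt ℝ Real.Gamma t := by
  refine Real.differentiableAt_Gamma fun m h => ht.2 m ?_
  rw [h]; simp

/-- Every value `v ≥ log |Γ(s)|` is taken by `log |Γ|` between `-k` and `s`. -/
lemma exists_log_abs_Gamma_eq {k : ℕ} {s : ℝ} (hs : s ∈ gammaInterval k) {v : ℝ}
    (hv : Real.log |Real.Gamma s| ≤ v) :
    ∃ t ∈ gammaInterval k, Real.log |Real.Gamma t| = v := by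
  have hs0 : Real.Gamma s ≠ 0 := Real.Gamma_ne_zero_of_mem (ofReal_mem_of_mem_gammaInterval hs)
  have hcont : ContinuousOn (fun t : ℝ => |(Real.Gamma t)⁻¹|) (Set.Icc (-(k : ℝ)) s) :=
    Real.continuous_inv_Gamma.abs.continuousOn
  have hle : Real.exp (-v) ≤ |(Real.Gamma s)⁻¹| := by
    rw [abs_inv, ← Real.exp_log (abs_pos.2 hs0), ← Real.exp_neg]
    exact Real.exp_le_exp.2 (by linarith)
  obtain ⟨t, ht, hteq⟩ := intermediate_value_Icc hs.1.le hcont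
    (show Real.exp (-v) ∈ Set.Icc _ _ from
      ⟨by simpa [Real.Gamma_neg_nat_eq_zero] using (Real.exp_pos (-v)).le, hle⟩)
  have hteq : |(Real.Gamma t)⁻¹| = Real.exp (-v) := hteq
  have hne : -(k : ℝ) ≠ t := by
    rintro rfl
    rw [Real.Gamma_neg_nat_eq_zero] at hteq
    simp at hteq
    exact (Real.exp_pos (-v)).ne hteq
  refine ⟨t, ⟨lt_of_le_of_ne ht.1 hne, hs.2.imp_right ht.2.trans_lt⟩, ?_⟩
  rw [abs_inv, Real.exp_neg, inv_inj] at hteq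
  rw [hteq, Real.log_exp]

lemma Real.Gamma_le_of_deriv_eq_zero {s t : ℝ} (hs : 0 < s) (hs' : deriv Real.Gamma s = 0)
    (ht : 0 < t) : Real.Gamma s ≤ Real.Gamma t := by
  have hd : HasDerivAt Real.Gamma 0 s := hs' ▸ (Real.differentiableAt_Gamma_of_mem
    (mem_of_re_pos (by simp) (by simpa using hs))).hasDerivAt
  refine Real.convexOn_Gamma.isMinOn_of_rightDeriv_eq_zero (by simpa using hs) ?_ ht
  exact hd.hasDerivWithinAt.derivWithin (uniqueDiffWithinAt_Ioi s)

/-- If `Γ` has a unique critical point in `(-k, -k+1)`, then `|Γ|` is minimal there. -/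
lemma abs_Gamma_le_of_unique_deriv_eq_zero {k : ℕ} {s : ℝ}
    (huniq : ∀ t ∈ Set.Ioo (-(k : ℝ)) (-(k : ℝ) + 1), deriv Real.Gamma t = 0 → t = s)
    (hk : 1 ≤ k) {t : ℝ} (ht : t ∈ Set.Ioo (-(k : ℝ)) (-(k : ℝ) + 1)) :
    |Real.Gamma s| ≤ |Real.Gamma t| := by
  have hmem {u : ℝ} (hu : u ∈ Set.Ioo (-(k : ℝ)) (-(k : ℝ) + 1)) : (u : ℂ) ∈ ℍ₀ :=
    ofReal_mem_of_mem_gammaInterval ⟨hu.1, Or.inr hu.2⟩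
  have hcont : ContinuousOn (fun t : ℝ => ((Real.Gamma t)⁻¹) ^ 2)
      (Set.Icc (-(k : ℝ)) (-(k : ℝ) + 1)) :=
    (Real.continuous_inv_Gamma.pow 2).continuousOn
  obtain ⟨m, hm, hmax⟩ := isCompact_Icc.exists_isMaxOn ⟨t, Set.Ioo_subset_Icc_self ht⟩ hcont
  have htm : ((Real.Gamma t)⁻¹) ^ 2 ≤ ((Real.Gamma m)⁻¹) ^ 2 := hmax (Set.Ioo_subset_Icc_self ht)
  have hpos : 0 < ((Real.Gamma t)⁻¹) ^ 2 := by
    have := Real.Gamma_ne_zero_of_mem (hmem ht)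
    positivity
  have hm0 : Real.Gamma m ≠ 0 := fun h => by
    rw [h, inv_zero, zero_pow two_ne_zero] at htm
    exact hpos.not_ge htm
  have hm1 : -(k : ℝ) ≠ m := fun h => hm0 (h ▸ Real.Gamma_neg_nat_eq_zero k)
  have hm2 : m ≠ -(k : ℝ) + 1 := fun h => hm0 (by
    have := Real.Gamma_neg_nat_eq_zero (k - 1)
    rwa [Nat.cast_sub hk, Nat.cast_one, neg_sub, sub_eq_neg_add, ← h] at this)
  have hm' : m ∈ Set.Ioo (-(k : ℝ)) (-(k : ℝ) + 1) :=
    ⟨lt_of_le_of_ne hm.1 hm1, lt_of_le_of_ne hm.2 hm2⟩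
  have hloc : IsLocalMax (fun t : ℝ => ((Real.Gamma t)⁻¹) ^ 2) m :=
    hmax.isLocalMax (Icc_mem_nhds hm'.1 hm'.2)
  have hder := ((Real.differentiableAt_Gamma_of_mem (hmem hm')).hasDerivAt.inv hm0).pow 2
  have hz := hloc.hasDerivAt_eq_zero hder
  have hcrit : deriv Real.Gamma m = 0 := by
    simpa [hm0] using hz
  rw [← huniq m hm' hcrit]
  rw [sq_le_sq, abs_inv, abs_inv] at htm
  exact (inv_le_inv₀ (abs_pos.2 (Real.Gamma_ne_zero_of_mem (hmem ht))) (abs_pos.2 hm0)).1 htm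

/-- The complement of a comb of horizontal slits going to the right is connected. -/
lemma isPreconnected_compl_comb (a : ℕ → ℝ) :
    IsPreconnected (Set.univ \ ⋃ k : ℕ, {w : ℂ | w.im = -(k : ℝ) * Real.pi ∧ a k ≤ w.re}) := by
  set Ω := Set.univ \ ⋃ k : ℕ, {w : ℂ | w.im = -(k : ℝ) * Real.pi ∧ a k ≤ w.re} with hΩ
  have hmem (w : ℂ) : w ∈ Ω ↔ ∀ k : ℕ, w.im = -(k : ℝ) * Real.pi → w.re < a k := by
    simp [hΩ]
  have hleft (w : ℂ) (hw : w ∈ Ω) (c : ℝ) (hc : c ≤ w.re) : JoinedIn Ω w ⟨c, w.im⟩ := by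
    refine JoinedIn.of_segment_subset fun u hu => ?_
    rw [hmem] at hw ⊢
    obtain ⟨p, q, hp, hq, hpq, rfl⟩ := hu
    intro k hk
    have him : (p • w + q • (⟨c, w.im⟩ : ℂ)).im = w.im := by
      simp; rw [← add_mul, hpq, one_mul]
    have hre : (p • w + q • (⟨c, w.im⟩ : ℂ)).re = p * w.re + q * c := by simp
    rw [him] at hk
    rw [hre]
    calc p * w.re + q * c ≤ p * w.re + q * w.re := by gcongr
      _ = w.re := by rw [← add_mul, hpq, one_mul]
      _ < a k := hw k hk
  refine isPreconnected_of_forall_pair fun w hw v hv => ?_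
  obtain ⟨N, hN⟩ := exists_nat_gt (max (-w.im) (-v.im))
  obtain ⟨b, hb⟩ := ((Set.finite_le_nat N).image a).bddBelow
  set c := min (b - 1) (min w.re v.re)
  have hvert : JoinedIn Ω ⟨c, w.im⟩ ⟨c, v.im⟩ := by
    refine JoinedIn.of_segment_subset fun u hu => ?_
    rw [hmem]
    obtain ⟨p, q, hp, hq, hpq, rfl⟩ := hu
    intro k hk
    have hre : (p • (⟨c, w.im⟩ : ℂ) + q • (⟨c, v.im⟩ : ℂ)).re = c := by
      simp; rw [← add_mul, hpq, one_mul]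
    have him : (p • (⟨c, w.im⟩ : ℂ) + q • (⟨c, v.im⟩ : ℂ)).im = p * w.im + q * v.im := by simp
    rw [him] at hk
    rw [hre]
    have h1 : -w.im < N := (le_max_left _ _).trans_lt hN
    have h2 : -v.im < N := (le_max_right _ _).trans_lt hN
    have hkN : (k : ℝ) ≤ N := by
      have h3 : (k : ℝ) * Real.pi ≤ N := by nlinarith
      nlinarith [Real.pi_gt_three, (k.cast_nonneg : (0 : ℝ) ≤ k)]
    have : b ≤ a k := hb ⟨k, by exact_mod_cast hkN, rfl⟩
    have : c ≤ b - 1 := min_le_left _ _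
    linarith
  have h1 := hleft w hw c ((min_le_right _ _).trans (min_le_left _ _))
  have h2 := hleft v hv c ((min_le_right _ _).trans (min_le_right _ _))
  obtain ⟨γ, hγ⟩ := (h1.trans hvert).trans h2.symm
  exact ⟨Set.range γ, Set.range_subset_iff.2 hγ, ⟨0, γ.source⟩, ⟨1, γ.target⟩,
    isPreconnected_range γ.continuous⟩

/-- Boundary values of `logGamma` on the real line are not taken inside the upper half plane. -/
lemma logGamma_ofReal_notMem_image {t : ℝ} (ht : (t : ℂ) ∈ ℍ₀) :
    logGamma t ∉ logGamma '' {z : ℂ | 0 < z.im} := by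
  rintro ⟨z, hz, hzt⟩
  have hz : 0 < z.im := hz
  set V : Set ℂ := {w | z.im / 2 < w.im}
  have hV : IsOpen V := isOpen_lt continuous_const Complex.continuous_im
  have hVsub : V ⊆ {z : ℂ | 0 < z.im} := fun w hw => lt_trans (half_pos hz) hw
  have hnhds : logGamma '' V ∈ 𝓝 (logGamma t) :=
    (isOpen_image_logGamma hV hVsub).mem_nhds ⟨z, half_lt_self hz, hzt⟩
  have hpath : Tendsto (fun y : ℝ => (t : ℂ) + y * Complex.I) (𝓝[>] 0) (𝓝[ℍ₀] (t : ℂ)) := by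
    refine tendsto_nhdsWithin_iff.2 ⟨?_, ?_⟩
    · have : Continuous fun y : ℝ => (t : ℂ) + y * Complex.I := by fun_prop
      simpa using (this.tendsto 0).mono_left nhdsWithin_le_nhds
    · filter_upwards [self_mem_nhdsWithin] with y hy
      exact mem_of_im_pos (by simpa using hy)
  have hev := ((continuousOn_logGamma t ht).tendsto.comp hpath).eventually hnhds
  have hsmall : ∀ᶠ y : ℝ in 𝓝[>] 0, y < z.im / 2 :=
    nhdsWithin_le_nhds (Iio_mem_nhds (half_pos hz))
  obtain ⟨y, ⟨⟨v, hv, hvy⟩, hy⟩, hy0⟩ := (hev.and hsmall |>.and self_mem_nhdsWithin).exists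
  have hy0 : 0 < y := hy0
  have := injOn_logGamma (hVsub hv) (by simpa using hy0 : 0 < ((t : ℂ) + y * Complex.I).im) hvy
  have hvim : z.im / 2 < v.im := hv
  rw [this] at hvim
  simp at hvim
  linarith

/-- The finite boundary of the image consists of boundary values on the real line. -/
lemma mem_image_or_eq_of_mem_closure {w : ℂ} (hw : w ∈ closure (logGamma '' {z : ℂ | 0 < z.im})) :
    w ∈ logGamma '' {z : ℂ | 0 < z.im} ∨ ∃ t : ℝ, (t : ℂ) ∈ ℍ₀ ∧ logGamma t = w := by
  obtain ⟨u, hu, hulim⟩ := mem_closure_iff_seq_limit.1 hw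
  choose z hz hzu using hu
  have hz : ∀ n, 0 < (z n).im := hz
  obtain ⟨M, hM⟩ := hulim.norm.bddAbove_range
  obtain ⟨R, hR⟩ := exists_norm_le_of_norm_logGamma_le M
  have hball (n : ℕ) : z n ∈ Metric.closedBall (0 : ℂ) R := by
    simpa using hR (z n) (hz n) (by rw [hzu]; exact hM ⟨n, rfl⟩)
  obtain ⟨z₀, -, φ, hφ, hlim⟩ := (isCompact_closedBall (0 : ℂ) R).tendsto_subseq hball
  have hLlim : Tendsto (fun n => logGamma (z (φ n))) atTop (𝓝 w) := by
    simpa [Function.comp_def, hzu] using hulim.comp hφ.tendsto_atTop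
  have him : 0 ≤ z₀.im := ge_of_tendsto' ((Complex.continuous_im.tendsto _).comp hlim)
    fun n => (hz (φ n)).le
  have hmem : z₀ ∈ ℍ₀ := by
    refine ⟨him, fun k hk => ?_⟩
    have h1 : Tendsto (fun n => (Complex.Gamma (z (φ n)))⁻¹) atTop (𝓝 (Complex.Gamma z₀)⁻¹) :=
      (Complex.differentiable_one_div_Gamma.continuous.tendsto z₀).comp hlim
    have h2 : Tendsto (fun n => (Complex.Gamma (z (φ n)))⁻¹) atTop (𝓝 (Complex.exp w)⁻¹) := by
      refine (((Complex.continuous_exp.tendsto _).comp hLlim).inv₀ (Complex.exp_ne_zero w)).congr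
        fun n => ?_
      simp only [Function.comp]
      rw [exp_logGamma (mem_of_im_pos (hz _))]
    have h3 := tendsto_nhds_unique h1 h2
    rw [eq_neg_of_add_eq_zero_left hk, Complex.Gamma_neg_nat_eq_zero, inv_zero] at h3
    exact inv_ne_zero (Complex.exp_ne_zero w) h3.symm
  have hlim' : Tendsto (z ∘ φ) atTop (𝓝[ℍ₀] z₀) :=
    tendsto_nhdsWithin_iff.2 ⟨hlim, Eventually.of_forall fun n => mem_of_im_pos (hz (φ n))⟩
  have heq : logGamma z₀ = w :=
    tendsto_nhds_unique ((continuousOn_logGamma z₀ hmem).tendsto.comp hlim') hLlim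
  rcases him.eq_or_lt with h | h
  · have hz₀ : ((z₀.re : ℝ) : ℂ) = z₀ := Complex.ext (by simp) (by simpa using h)
    exact Or.inr ⟨z₀.re, hz₀.symm ▸ hmem, by rw [hz₀, heq]⟩
  · exact Or.inl ⟨z₀, h, heq⟩

/-- `L` is injective on the open upper half plane `ℂ₊`, and its image is
the comb domain `ℂ ∖ ⋃_{k≥0} { x − ikπ : x ≥ log |Γ(x_k)| }`, where for `k ≥ 1`, `x_k` is
the unique critical point of `Γ` in `(−k, −k+1)` and `x_0` is the unique zero of
`ψ = Γ'/Γ` on `(0,∞)`. -/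
theorem logGamma_injOn_and_image_comb (x : ℕ → ℝ)
    (hx0 : x 0 ∈ Set.Ioi (0 : ℝ) ∧ deriv Real.Gamma (x 0) = 0)
    (hx0uniq : ∀ t ∈ Set.Ioi (0 : ℝ), deriv Real.Gamma t = 0 → t = x 0)
    (hxk : ∀ k : ℕ, 1 ≤ k → x k ∈ Set.Ioo (-(k : ℝ)) (-(k : ℝ) + 1) ∧
      deriv Real.Gamma (x k) = 0)
    (hxkuniq : ∀ k : ℕ, 1 ≤ k → ∀ t ∈ Set.Ioo (-(k : ℝ)) (-(k : ℝ) + 1),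
      deriv Real.Gamma t = 0 → t = x k) :
    Set.InjOn logGamma {z : ℂ | 0 < z.im} ∧
    logGamma '' {z : ℂ | 0 < z.im} =
      Set.univ \ ⋃ k : ℕ,
        {w : ℂ | w.im = -(k : ℝ) * Real.pi ∧ Real.log |Real.Gamma (x k)| ≤ w.re} := by
  have hmem (k : ℕ) : x k ∈ gammaInterval k := by
    rcases Nat.eq_zero_or_pos k with rfl | hk
    · exact ⟨by simpa using hx0.1, Or.inl rfl⟩
    · exact ⟨(hxk k hk).1.1, Or.inr (hxk k hk).1.2⟩
  have hmin (k : ℕ) {t : ℝ} (ht : t ∈ gammaInterval k) : |Real.Gamma (x k)| ≤ |Real.Gamma t| := by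
    rcases Nat.eq_zero_or_pos k with rfl | hk
    · have ht0 : 0 < t := by simpa using ht.1
      rw [abs_of_pos (Real.Gamma_pos_of_pos hx0.1), abs_of_pos (Real.Gamma_pos_of_pos ht0)]
      exact Real.Gamma_le_of_deriv_eq_zero hx0.1 hx0.2 ht0
    · exact abs_Gamma_le_of_unique_deriv_eq_zero (hxkuniq k hk) hk
        ⟨ht.1, ht.2.resolve_left hk.ne'⟩
  have hsub : logGamma '' {z : ℂ | 0 < z.im} ⊆ Set.univ \ ⋃ k : ℕ,
      {w : ℂ | w.im = -(k : ℝ) * Real.pi ∧ Real.log |Real.Gamma (x k)| ≤ w.re} := by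
    refine fun w hw => ⟨Set.mem_univ w, fun hcomb => ?_⟩
    obtain ⟨k, him, hre⟩ := Set.mem_iUnion.1 hcomb
    obtain ⟨t, ht, hlog⟩ := exists_log_abs_Gamma_eq (hmem k) hre
    have htm := ofReal_mem_of_mem_gammaInterval ht
    have heq : logGamma t = w := Complex.ext (by rw [re_logGamma_ofReal htm, hlog])
      (by rw [im_logGamma_ofReal k t ht, him])
    exact logGamma_ofReal_notMem_image htm (heq ▸ hw)
  refine ⟨injOn_logGamma, hsub.antisymm ?_⟩
  refine (isPreconnected_compl_comb _).subset_of_closure_inter_subset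
    (isOpen_image_logGamma (isOpen_lt continuous_const Complex.continuous_im) subset_rfl) ?_ ?_
  · have hI : logGamma Complex.I ∈ logGamma '' {z : ℂ | 0 < z.im} := ⟨Complex.I, by simp, rfl⟩
    exact ⟨_, hsub hI, hI⟩
  · rintro w ⟨hw, hwcomb⟩
    refine (mem_image_or_eq_of_mem_closure hw).resolve_right ?_
    rintro ⟨t, ht, rfl⟩
    obtain ⟨k, hk⟩ := exists_mem_gammaInterval ht
    refine hwcomb.2 (Set.mem_iUnion.2 ⟨k, im_logGamma_ofReal k t hk, ?_⟩)
    rw [re_logGamma_ofReal ht]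
    exact Real.log_le_log (abs_pos.2 (Real.Gamma_ne_zero_of_mem
      (ofReal_mem_of_mem_gammaInterval (hmem k)))) (hmin k hk)
end
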